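/- Let y = v_j be a vertex and x ∈ [v_1, v_n] a point with y < x. Then sup_{s ∈ S} Γ^s(x, y) = sup { Γ^s(x, y) : s ∈ S, w_l^s = w_l^+ for every index l with v_l ≤ y, and w_l^s = w_l^− for every index l with v_l ≥ x }; in particular, if a worst case scenario for ⟨x, y⟩ exists, then one exists assigning the maximum weight to every vertex in [v_1, y] and the minimum weight to every vertex in [x, v_n]. -/

import Mathlib

open Finset
open scoped Classical

namespace DPN

noncomputable def score (τ c : ℝ) (v w : ℕ → ℝ) (h r j : ℕ) : ℝ :=
  τ * (v h - v j) + (∑ l ∈ Finset.Ioc r j, w l) / c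

noncomputable def nextHead (τ c : ℝ) (v w : ℕ → ℝ) (h r : ℕ) : ℕ :=
  (((Finset.Ioc r h).filter (fun j =>
      ∀ j' ∈ Finset.Ioc r h, score τ c v w h r j' ≤ score τ c v w h r j)).max).getD h

noncomputable def heads (τ c : ℝ) (v w : ℕ → ℝ) (h : ℕ) : ℕ → ℕ
  | 0 => 0
  | m + 1 => nextHead τ c v w h (heads τ c v w h m)

noncomputable def hIdx (n : ℕ) (v : ℕ → ℝ) (x : ℝ) : ℕ :=
  ((Finset.Icc 1 n).filter (fun i => v i < x)).card

noncomputable def phiL (n : ℕ) (τ c : ℝ) (v w : ℕ → ℝ) (x : ℝ) : ℝ :=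
  ∑ m ∈ Finset.range n,
    ((∑ l ∈ Finset.Ioc (heads τ c v w (hIdx n v x) m) (heads τ c v w (hIdx n v x) (m + 1)), w l) *
        (τ * (x - v (heads τ c v w (hIdx n v x) (m + 1)))) +
      (∑ l ∈ Finset.Ioc (heads τ c v w (hIdx n v x) m) (heads τ c v w (hIdx n v x) (m + 1)), w l) ^ 2 /
        (2 * c))

def rv (n : ℕ) (v : ℕ → ℝ) : ℕ → ℝ := fun l => -v (n + 1 - l)

def rw (n : ℕ) (w : ℕ → ℝ) : ℕ → ℝ := fun l => w (n + 1 - l)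

noncomputable def phiR (n : ℕ) (τ c : ℝ) (v w : ℕ → ℝ) (x : ℝ) : ℝ :=
  phiL n τ c (rv n v) (rw n w) (-x)

noncomputable def phi (n : ℕ) (τ c : ℝ) (v w : ℕ → ℝ) (x : ℝ) : ℝ :=
  phiL n τ c v w x + phiR n τ c v w x

/-- The set of scenarios: each vertex weight lies in its interval. -/
def scenarios (n : ℕ) (wm wp : ℕ → ℝ) : Set (ℕ → ℝ) :=
  {s | ∀ i, 1 ≤ i → i ≤ n → wm i ≤ s i ∧ s i ≤ wp i}

/-- The gap `Γ^s(x, y) = Φ^s(x) − Φ^s(y)`. -/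
noncomputable def gap (n : ℕ) (τ c : ℝ) (v s : ℕ → ℝ) (x y : ℝ) : ℝ :=
  phi n τ c v s x - phi n τ c v s y

/-- The regret `R^s(x) = Φ^s(x) − Φ^s(m^s)` (`Φ^s(m^s)` = min of `Φ^s` on `[v_1, v_n]`). -/
noncomputable def regret (n : ℕ) (τ c : ℝ) (v s : ℕ → ℝ) (x : ℝ) : ℝ :=
  phi n τ c v s x - sInf ((fun z => phi n τ c v s z) '' Set.Icc (v 1) (v n))

/-- The maximum regret `R_max(x) = sup_{s ∈ S} R^s(x)`. -/
noncomputable def maxRegret (n : ℕ) (τ c : ℝ) (v wm wp : ℕ → ℝ) (x : ℝ) : ℝ :=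
  sSup {r | ∃ s ∈ scenarios n wm wp, r = regret n τ c v s x}

/-- The left-pseudo-bipartite scenario `s(i, w)`. -/
def pseudoBipL (wm wp : ℕ → ℝ) (i : ℕ) (w : ℝ) : ℕ → ℝ :=
  fun l => if l < i then wp l else if l = i then w else wm l

/-- The right-pseudo-bipartite scenario `s(i, w)`. -/
def pseudoBipR (wm wp : ℕ → ℝ) (i : ℕ) (w : ℝ) : ℕ → ℝ :=
  fun l => if l < i then wm l else if l = i then w else wp l

/-- The head `ρ_m` of the left cluster containing vertex `i`: the smallest cluster head `≥ i`. -/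
noncomputable def clusterHeadOf (τ c : ℝ) (v w : ℕ → ℝ) (h i : ℕ) : ℕ :=
  ((((Finset.range (h + 1)).image (heads τ c v w h)).filter (fun r => i ≤ r)).min).getD h

/-- The head `ρ_{m−1}` preceding the left cluster containing vertex `i`:
the largest cluster head `< i`. -/
noncomputable def prevClusterHeadOf (τ c : ℝ) (v w : ℕ → ℝ) (h i : ℕ) : ℕ :=
  ((((Finset.range (h + 1)).image (heads τ c v w h)).filter (fun r => r < i)).max).getD 0

/-- The weight `σ_m` of the left cluster containing vertex `i`. -/
noncomputable def clusterWeightOf (τ c : ℝ) (v w : ℕ → ℝ) (h i : ℕ) : ℝ :=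
  ∑ l ∈ Finset.Ioc (prevClusterHeadOf τ c v w h i) (clusterHeadOf τ c v w h i), w l

/-- The sequence of right cluster heads for the vertex `y = v_j`
(expressed in the coordinates of the reflected network). -/
noncomputable def rightHeads (n : ℕ) (τ c : ℝ) (v w : ℕ → ℝ) (j : ℕ) : ℕ → ℕ :=
  heads τ c (rv n v) (rw n w) (hIdx n (rv n v) (-(v j)))

/-- The sequence of left cluster heads for the vertex `y = v_j`. -/
noncomputable def leftHeads (n : ℕ) (τ c : ℝ) (v w : ℕ → ℝ) (j : ℕ) : ℕ → ℕ :=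
  heads τ c v w (hIdx n v (v j))

/-- The (original-coordinates) index of the head of the right cluster for `y = v_j`
containing vertex `i`. -/
noncomputable def rightClusterHeadOf (n : ℕ) (τ c : ℝ) (v w : ℕ → ℝ) (j i : ℕ) : ℕ :=
  n + 1 - clusterHeadOf τ c (rv n v) (rw n w) (hIdx n (rv n v) (-(v j))) (n + 1 - i)

/-- The weight of the right cluster for `y = v_j` containing vertex `i`. -/
noncomputable def rightClusterWeightOf (n : ℕ) (τ c : ℝ) (v w : ℕ → ℝ) (j i : ℕ) : ℝ :=
  clusterWeightOf τ c (rv n v) (rw n w) (hIdx n (rv n v) (-(v j))) (n + 1 - i)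

/-- `ω` is a critical weight for `v_i` with respect to the vertex `y = v_j`
(left-pseudo-bipartite case): `ω ∈ {w_i^−, w_i^+}` or the right-cluster partition for `y`
under `s(i, ·)` is not constant on any neighborhood of `ω` in `[w_i^−, w_i^+]`. -/
def criticalWeightL (n : ℕ) (τ c : ℝ) (v wm wp : ℕ → ℝ) (j i : ℕ) (ω : ℝ) : Prop :=
  ω ∈ Set.Icc (wm i) (wp i) ∧
    (ω = wm i ∨ ω = wp i ∨
      ¬ ∃ ε > (0 : ℝ), ∀ w ∈ Set.Icc (wm i) (wp i), |w - ω| < ε →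
        rightHeads n τ c v (pseudoBipL wm wp i w) j =
          rightHeads n τ c v (pseudoBipL wm wp i ω) j)

/-- `ω` is a critical weight for `v_i` with respect to the vertex `y = v_j`
(right-pseudo-bipartite case, using the left-cluster partition for `y`). -/
def criticalWeightR (n : ℕ) (τ c : ℝ) (v wm wp : ℕ → ℝ) (j i : ℕ) (ω : ℝ) : Prop :=
  ω ∈ Set.Icc (wm i) (wp i) ∧
    (ω = wm i ∨ ω = wp i ∨
      ¬ ∃ ε > (0 : ℝ), ∀ w ∈ Set.Icc (wm i) (wp i), |w - ω| < ε →
        leftHeads n τ c v (pseudoBipR wm wp i w) j =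
          leftHeads n τ c v (pseudoBipR wm wp i ω) j)

/-- `Q`: the number of right clusters for `y = v_j` under weights `w` that lie entirely
to the right of the right cluster containing `v_i` (counted via reflected cluster heads). -/
noncomputable def Qnum (n : ℕ) (τ c : ℝ) (v w : ℕ → ℝ) (j i : ℕ) : ℕ :=
  (((Finset.range (n + 1)).image (rightHeads n τ c v w j)).filter
      (fun r => 1 ≤ r ∧
        r < clusterHeadOf τ c (rv n v) (rw n w) (hIdx n (rv n v) (-(v j))) (n + 1 - i))).card

end DPN

open DPN

namespace DPN

theorem nextHead_self (τ c : ℝ) (v w : ℕ → ℝ) (h : ℕ) : nextHead τ c v w h h = h := by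
  unfold nextHead
  simp [Finset.max, Option.getD, Bot.bot]

/-- While some vertex remains, the next head is a vertex of maximal score. -/
theorem nextHead_spec (τ c : ℝ) (v w : ℕ → ℝ) {h r : ℕ} (hr : r < h) :
    nextHead τ c v w h r ∈ Finset.Ioc r h ∧ ∀ j ∈ Finset.Ioc r h,
      score τ c v w h r j ≤ score τ c v w h r (nextHead τ c v w h r) := by
  obtain ⟨a, ha, hmax⟩ := Finset.exists_max_image (Finset.Ioc r h) (score τ c v w h r)
    ⟨h, by simp [hr]⟩
  obtain ⟨b, hb⟩ := Finset.max_of_mem (s := (Finset.Ioc r h).filter fun j =>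
    ∀ j' ∈ Finset.Ioc r h, score τ c v w h r j' ≤ score τ c v w h r j)
    (Finset.mem_filter.2 ⟨ha, hmax⟩)
  have hmem := Finset.mem_filter.1 (Finset.mem_of_max hb)
  have hnext : nextHead τ c v w h r = b := by
    unfold nextHead
    rw [hb]
    rfl
  rw [hnext]
  exact hmem

theorem heads_le (τ c : ℝ) (v w : ℕ → ℝ) (h m : ℕ) : heads τ c v w h m ≤ h := by
  induction m with
  | zero => exact Nat.zero_le h
  | succ m ih =>
    change nextHead τ c v w h (heads τ c v w h m) ≤ h
    rcases ih.eq_or_lt with heq | hlt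
    · rw [heq, nextHead_self]
    · exact (Finset.mem_Ioc.1 (nextHead_spec τ c v w hlt).1).2

theorem heads_le_succ (τ c : ℝ) (v w : ℕ → ℝ) (h m : ℕ) :
    heads τ c v w h m ≤ heads τ c v w h (m + 1) := by
  change _ ≤ nextHead τ c v w h (heads τ c v w h m)
  rcases (heads_le τ c v w h m).eq_or_lt with heq | hlt
  · rw [heq, nextHead_self]
  · exact (Finset.mem_Ioc.1 (nextHead_spec τ c v w hlt).1).1.le

theorem min_le_heads (τ c : ℝ) (v w : ℕ → ℝ) (h m : ℕ) : min m h ≤ heads τ c v w h m := by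
  induction m with
  | zero => simp
  | succ m ih =>
    change _ ≤ nextHead τ c v w h (heads τ c v w h m)
    rcases (heads_le τ c v w h m).eq_or_lt with heq | hlt
    · rw [heq, nextHead_self]
      exact min_le_right _ _
    · have := (Finset.mem_Ioc.1 (nextHead_spec τ c v w hlt).1).1
      omega

/-- The arrival time at `x` of the last unit starting at `v i`, not counting the time spent
queueing behind other units of the same vertex, when only the vertices up to `h` evacuate. -/
noncomputable def delay (τ c : ℝ) (v w : ℕ → ℝ) (x : ℝ) (h i : ℕ) : ℝ :=
  sSup ((fun j => τ * (x - v j) + (∑ l ∈ Finset.Ioc i j, w l) / c) ''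
    (Finset.Icc i h : Set ℕ))

theorem le_delay (τ c : ℝ) (v w : ℕ → ℝ) (x : ℝ) {h i j : ℕ} (hij : i ≤ j) (hjh : j ≤ h) :
    τ * (x - v j) + (∑ l ∈ Finset.Ioc i j, w l) / c ≤ delay τ c v w x h i :=
  le_csSup ((Finset.finite_toSet _).image _).bddAbove
    ⟨j, Finset.mem_coe.2 (Finset.mem_Icc.2 ⟨hij, hjh⟩), rfl⟩

theorem exists_delay_eq (τ c : ℝ) (v w : ℕ → ℝ) (x : ℝ) {h i : ℕ} (hih : i ≤ h) :
    ∃ j, i ≤ j ∧ j ≤ h ∧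
      delay τ c v w x h i = τ * (x - v j) + (∑ l ∈ Finset.Ioc i j, w l) / c := by
  have hne : ((fun j => τ * (x - v j) + (∑ l ∈ Finset.Ioc i j, w l) / c) ''
      (Finset.Icc i h : Set ℕ)).Nonempty :=
    Set.Nonempty.image _ ⟨i, Finset.mem_coe.2 (Finset.mem_Icc.2 ⟨le_rfl, hih⟩)⟩
  obtain ⟨j, hj, hjeq⟩ := hne.csSup_mem ((Finset.finite_toSet _).image _)
  have hj' := Finset.mem_Icc.1 (Finset.mem_coe.1 hj)
  exact ⟨j, hj'.1, hj'.2, hjeq.symm⟩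

theorem sum_mul_tail (w : ℕ → ℝ) (a c : ℝ) {r ρ : ℕ} (hr : r ≤ ρ) :
    ∑ i ∈ Finset.Ioc r ρ, (w i * (a + (∑ l ∈ Finset.Ioc i ρ, w l) / c) + w i ^ 2 / (2 * c)) =
      (∑ l ∈ Finset.Ioc r ρ, w l) * a + (∑ l ∈ Finset.Ioc r ρ, w l) ^ 2 / (2 * c) := by
  induction hr using Nat.decreasingInduction with
  | self => simp
  | of_succ k hk ih =>
    rw [← Finset.sum_Ioc_consecutive _ (Nat.le_succ k) hk, ih,
      ← Finset.sum_Ioc_consecutive w (Nat.le_succ k) hk]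
    simp only [Nat.succ_eq_add_one, Nat.Ioc_succ_singleton, Finset.sum_singleton]
    ring

/-- Within a cluster the delay is determined by the head of the cluster. -/
theorem delay_eq_of_mem_cluster (τ c : ℝ) (v w : ℕ → ℝ) (x : ℝ) {h r i : ℕ} (hr : r < h)
    (hi : i ∈ Finset.Ioc r (nextHead τ c v w h r)) :
    delay τ c v w x h i = τ * (x - v (nextHead τ c v w h r)) +
      (∑ l ∈ Finset.Ioc i (nextHead τ c v w h r), w l) / c := by
  obtain ⟨hmem, hmax⟩ := nextHead_spec τ c v w hr
  rw [Finset.mem_Ioc] at hi hmem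
  refine le_antisymm ?_ (le_delay τ c v w x hi.2 hmem.2)
  obtain ⟨k, hik, hkh, hk⟩ := exists_delay_eq τ c v w x (hi.2.trans hmem.2)
  have hscore := hmax k (Finset.mem_Ioc.2 ⟨hi.1.trans_le hik, hkh⟩)
  unfold score at hscore
  rw [← Finset.sum_Ioc_consecutive w hi.1.le hik,
    ← Finset.sum_Ioc_consecutive w hi.1.le hi.2, add_div, add_div] at hscore
  rw [hk]
  linarith

theorem hIdx_le (n : ℕ) (v : ℕ → ℝ) (x : ℝ) : hIdx n v x ≤ n := by
  unfold hIdx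
  exact (Finset.card_filter_le _ _).trans (by simp)

/-- The total left evacuation time as a sum over vertices instead of clusters. -/
theorem phiL_eq_sum_delay (n : ℕ) (τ c : ℝ) (v w : ℕ → ℝ) (x : ℝ) :
    phiL n τ c v w x = ∑ i ∈ Finset.Ioc 0 (hIdx n v x),
      (w i * delay τ c v w x (hIdx n v x) i + w i ^ 2 / (2 * c)) := by
  unfold phiL
  have hn := hIdx_le n v x
  generalize hIdx n v x = h at hn ⊢
  have key : ∀ N, ∑ m ∈ Finset.range N,
      ((∑ l ∈ Finset.Ioc (heads τ c v w h m) (heads τ c v w h (m + 1)), w l) *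
        (τ * (x - v (heads τ c v w h (m + 1)))) +
      (∑ l ∈ Finset.Ioc (heads τ c v w h m) (heads τ c v w h (m + 1)), w l) ^ 2 / (2 * c)) =
      ∑ i ∈ Finset.Ioc 0 (heads τ c v w h N),
        (w i * delay τ c v w x h i + w i ^ 2 / (2 * c)) := by
    intro N
    induction N with
    | zero => simp [heads]
    | succ N ih =>
      rw [Finset.sum_range_succ, ih, ← Finset.sum_Ioc_consecutive _ (Nat.zero_le _)
        (heads_le_succ τ c v w h N), ← sum_mul_tail w _ c (heads_le_succ τ c v w h N)]
      congr 1
      refine Finset.sum_congr rfl fun i hi => ?_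
      rcases (heads_le τ c v w h N).eq_or_lt with heq | hlt
      · have := heads_le τ c v w h (N + 1)
        rw [Finset.mem_Ioc] at hi
        omega
      · rw [delay_eq_of_mem_cluster τ c v w x hlt hi]
        rfl
  have hlast : heads τ c v w h n = h :=
    le_antisymm (heads_le τ c v w h n) (by simpa [hn] using min_le_heads τ c v w h n)
  rw [key, hlast]

theorem lt_iff_le_hIdx {n : ℕ} {v : ℕ → ℝ} (hv : ∀ i, 1 ≤ i → i < n → v i < v (i + 1))
    {l : ℕ} (hl : 1 ≤ l) (hln : l ≤ n) (x : ℝ) : v l < x ↔ l ≤ hIdx n v x := by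
  have hmono : ∀ a b, 1 ≤ a → a ≤ b → b ≤ n → v a ≤ v b := by
    intro a b ha hab
    induction b, hab using Nat.le_induction with
    | base => exact fun _ => le_rfl
    | succ b hab ih => exact fun hb => (ih (by omega)).trans (hv b (by omega) (by omega)).le
  constructor
  · intro hlt
    have hsub : Finset.Icc 1 l ⊆ (Finset.Icc 1 n).filter (fun i => v i < x) := by
      intro i hi
      rw [Finset.mem_Icc] at hi
      exact Finset.mem_filter.2 ⟨Finset.mem_Icc.2 ⟨hi.1, hi.2.trans hln⟩,
        (hmono i l hi.1 hi.2 hln).trans_lt hlt⟩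
    simpa [hIdx] using Finset.card_le_card hsub
  · intro hle
    by_contra hge
    have hsub : (Finset.Icc 1 n).filter (fun i => v i < x) ⊆ Finset.Icc 1 (l - 1) := by
      intro i hi
      rw [Finset.mem_filter, Finset.mem_Icc] at hi
      rw [Finset.mem_Icc]
      refine ⟨hi.1.1, ?_⟩
      by_contra hlarge
      exact hge ((hmono l i hl (by omega) hi.1.2).trans_lt hi.2)
    have hcard := Finset.card_le_card hsub
    rw [Nat.card_Icc] at hcard
    unfold hIdx at hle
    omega

/-- The increase of the delay from `y` to `x` is monotone in the weights. -/
theorem delay_sub_le_delay_sub {τ c : ℝ} (hc : 0 < c) (v : ℕ → ℝ) {w w' : ℕ → ℝ} (x y : ℝ)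
    {h h' i : ℕ} (hih : i ≤ h') (hh : h' ≤ h)
    (hw : ∀ l, i < l → l ≤ h → w l ≤ w' l) :
    delay τ c v w x h i - delay τ c v w y h' i ≤
      delay τ c v w' x h i - delay τ c v w' y h' i := by
  obtain ⟨j, hij, hjh, hj⟩ := exists_delay_eq τ c v w x (hih.trans hh)
  obtain ⟨k, hik, hkh, hk⟩ := exists_delay_eq τ c v w' y hih
  rcases le_total j k with hjk | hkj
  · have h1 := le_delay τ c v w' x hik (hkh.trans hh)
    have h2 := le_delay τ c v w y hij (hjk.trans hkh)
    linarith
  · have h1 := le_delay τ c v w' x hij hjh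
    have h2 := le_delay τ c v w y hik hkh
    have h3 : (∑ l ∈ Finset.Ioc k j, w l) / c ≤ (∑ l ∈ Finset.Ioc k j, w' l) / c := by
      refine div_le_div_of_nonneg_right (Finset.sum_le_sum fun l hl => ?_) hc.le
      rw [Finset.mem_Ioc] at hl
      exact hw l (hik.trans_lt hl.1) (hl.2.trans hjh)
    rw [← Finset.sum_Ioc_consecutive w hik hkj, add_div] at hj
    rw [← Finset.sum_Ioc_consecutive w' hik hkj, add_div] at h1
    linarith

/-- The increase of the left evacuation time from `y` to `x` is monotone in the weights of
the vertices to the left of `x`. -/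
theorem phiL_sub_le_phiL_sub {n : ℕ} {τ c : ℝ} (hτ : 0 < τ) (hc : 0 < c) {v : ℕ → ℝ}
    (hv : ∀ i, 1 ≤ i → i < n → v i < v (i + 1)) {w w' : ℕ → ℝ} {x y : ℝ} (hyx : y ≤ x)
    (hw0 : ∀ l, 1 ≤ l → l ≤ n → 0 ≤ w l)
    (hw : ∀ l, 1 ≤ l → l ≤ n → v l < x → w l ≤ w' l) :
    phiL n τ c v w x - phiL n τ c v w y ≤ phiL n τ c v w' x - phiL n τ c v w' y := by
  have hh : hIdx n v y ≤ hIdx n v x := by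
    unfold hIdx
    exact Finset.card_le_card (Finset.monotone_filter_right _ fun i _ hi => hi.trans_le hyx)
  have hn := hIdx_le n v x
  have hlt : ∀ l, 1 ≤ l → l ≤ hIdx n v x → v l < x := fun l hl hlh =>
    (lt_iff_le_hIdx hv hl (hlh.trans hn) x).2 hlh
  simp only [phiL_eq_sum_delay]
  generalize hIdx n v x = h at *
  generalize hIdx n v y = h' at *
  have hww : ∀ l, 1 ≤ l → l ≤ h → w l ≤ w' l := fun l hl hlh =>
    hw l hl (hlh.trans hn) (hlt l hl hlh)
  rw [← Finset.sum_Ioc_consecutive _ (Nat.zero_le h') hh,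
    ← Finset.sum_Ioc_consecutive _ (Nat.zero_le h') hh, add_sub_right_comm,
    add_sub_right_comm, ← Finset.sum_sub_distrib, ← Finset.sum_sub_distrib]
  refine add_le_add (Finset.sum_le_sum fun i hi => ?_) (Finset.sum_le_sum fun i hi => ?_)
  · rw [Finset.mem_Ioc] at hi
    have hD := delay_sub_le_delay_sub (τ := τ) hc v x y hi.2 hh
      (fun l hl hlh => hww l (by omega) hlh)
    have hD0 : 0 ≤ delay τ c v w x h i - delay τ c v w y h' i := by
      obtain ⟨k, hik, hkh, hk⟩ := exists_delay_eq τ c v w y hi.2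
      have h1 := le_delay τ c v w x hik (hkh.trans hh)
      have h2 := mul_le_mul_of_nonneg_left (sub_le_sub_right hyx (v k)) hτ.le
      linarith
    have h0 := hw0 i hi.1 (hi.2.trans (hh.trans hn))
    have h1 := hww i hi.1 (hi.2.trans hh)
    have := mul_le_mul h1 hD hD0 (h0.trans h1)
    linarith
  · rw [Finset.mem_Ioc] at hi
    have hi1 : 1 ≤ i := by omega
    have h0 := hw0 i hi1 (hi.2.trans hn)
    have h1 := hww i hi1 hi.2
    have hD0 : 0 ≤ delay τ c v w x h i := by
      refine le_trans ?_ (le_delay τ c v w x le_rfl hi.2)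
      have := mul_pos hτ (sub_pos.2 (hlt i hi1 hi.2))
      simpa using this.le
    have hD : delay τ c v w x h i ≤ delay τ c v w' x h i := by
      obtain ⟨k, hik, hkh, hk⟩ := exists_delay_eq τ c v w x hi.2
      rw [hk]
      refine le_trans ?_ (le_delay τ c v w' x hik hkh)
      gcongr with l hl
      rw [Finset.mem_Ioc] at hl
      exact hww l (by omega) (hl.2.trans hkh)
    have := mul_le_mul h1 hD hD0 (h0.trans h1)
    gcongr

/-- Raising weights strictly left of `x` and lowering weights strictly right of `y`, where
`y ≤ x`, does not decrease the gap; weights strictly between must therefore stay the same. -/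
theorem gap_le_gap {n : ℕ} {τ c : ℝ} (hτ : 0 < τ) (hc : 0 < c) {v : ℕ → ℝ}
    (hv : ∀ i, 1 ≤ i → i < n → v i < v (i + 1)) {s s' : ℕ → ℝ} {x y : ℝ} (hyx : y ≤ x)
    (hs : ∀ l, 1 ≤ l → l ≤ n → 0 ≤ s l) (hs' : ∀ l, 1 ≤ l → l ≤ n → 0 ≤ s' l)
    (hleft : ∀ l, 1 ≤ l → l ≤ n → v l < x → s l ≤ s' l)
    (hright : ∀ l, 1 ≤ l → l ≤ n → y < v l → s' l ≤ s l) :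
    gap n τ c v s x y ≤ gap n τ c v s' x y := by
  have hrv : ∀ i, 1 ≤ i → i < n → rv n v i < rv n v (i + 1) := by
    intro i hi hin
    have := hv (n - i) (by omega) (by omega)
    unfold rv
    rw [show n + 1 - (i + 1) = n - i by omega, show n + 1 - i = n - i + 1 by omega]
    exact neg_lt_neg this
  have hL := phiL_sub_le_phiL_sub hτ hc hv hyx hs hleft
  have hR := phiL_sub_le_phiL_sub (w := rw n s') (w' := rw n s) hτ hc hrv (neg_le_neg hyx)
    (fun l _ _ => hs' _ (by omega) (by omega))
    (fun l _ _ hlt => hright _ (by omega) (by omega) (neg_lt_neg_iff.1 hlt))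
  unfold gap phi phiR
  linarith

end DPN

theorem stmt8 (n : ℕ) (τ c : ℝ) (hτ : 0 < τ) (hc : 0 < c) (v : ℕ → ℝ)
    (hv : ∀ i, 1 ≤ i → i < n → v i < v (i + 1))
    (wm wp : ℕ → ℝ) (hwm : ∀ i, 1 ≤ i → i ≤ n → 0 < wm i)
    (hwmp : ∀ i, 1 ≤ i → i ≤ n → wm i ≤ wp i)
    (j : ℕ) (hj1 : 1 ≤ j) (hjn : j ≤ n)
    (x : ℝ) (hx : x ∈ Set.Icc (v 1) (v n)) (hyx : v j < x) :
    sSup {g | ∃ s ∈ scenarios n wm wp, g = gap n τ c v s x (v j)} =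
        sSup {g | ∃ s ∈ scenarios n wm wp,
          (∀ l, 1 ≤ l → l ≤ n → v l ≤ v j → s l = wp l) ∧
            (∀ l, 1 ≤ l → l ≤ n → x ≤ v l → s l = wm l) ∧
            g = gap n τ c v s x (v j)} ∧
      ((∃ s ∈ scenarios n wm wp, ∀ s' ∈ scenarios n wm wp,
          gap n τ c v s' x (v j) ≤ gap n τ c v s x (v j)) →
        ∃ s ∈ scenarios n wm wp,
          (∀ l, 1 ≤ l → l ≤ n → v l ≤ v j → s l = wp l) ∧
            (∀ l, 1 ≤ l → l ≤ n → x ≤ v l → s l = wm l) ∧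
            ∀ s' ∈ scenarios n wm wp,
              gap n τ c v s' x (v j) ≤ gap n τ c v s x (v j)) := by
  have key : ∀ s ∈ scenarios n wm wp, ∃ s' ∈ scenarios n wm wp,
      (∀ l, 1 ≤ l → l ≤ n → v l ≤ v j → s' l = wp l) ∧
        (∀ l, 1 ≤ l → l ≤ n → x ≤ v l → s' l = wm l) ∧
        gap n τ c v s x (v j) ≤ gap n τ c v s' x (v j) := by
    intro s hs
    let s' : ℕ → ℝ := fun l => if v l ≤ v j then wp l else if x ≤ v l then wm l else s l
    have hs' : s' ∈ scenarios n wm wp := by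
      intro i hi hin
      dsimp only [s']
      split_ifs
      · exact ⟨hwmp i hi hin, le_rfl⟩
      · exact ⟨le_rfl, hwmp i hi hin⟩
      · exact hs i hi hin
    have hpos : ∀ t ∈ scenarios n wm wp, ∀ l, 1 ≤ l → l ≤ n → 0 ≤ t l := fun t ht l hl hln =>
      (hwm l hl hln).le.trans (ht l hl hln).1
    refine ⟨s', hs', fun l _ _ hl => if_pos hl, fun l _ _ hl => ?_,
      gap_le_gap hτ hc hv hyx.le (hpos s hs) (hpos s' hs') (fun l hl hln hlx => ?_)
        (fun l hl hln hly => ?_)⟩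
    · dsimp only [s']
      rw [if_neg (hyx.trans_le hl).not_ge, if_pos hl]
    · dsimp only [s']
      rw [if_neg hlx.not_ge]
      split_ifs
      · exact (hs l hl hln).2
      · exact le_rfl
    · dsimp only [s']
      rw [if_neg hly.not_ge]
      split_ifs
      · exact (hs l hl hln).1
      · exact le_rfl
  refine ⟨csSup_eq_csSup_of_forall_exists_le ?_ ?_, ?_⟩
  · rintro _ ⟨s, hs, rfl⟩
    obtain ⟨s', hs', h1, h2, hle⟩ := key s hs
    exact ⟨_, ⟨s', hs', h1, h2, rfl⟩, hle⟩
  · rintro _ ⟨s, hs, -, -, rfl⟩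
    exact ⟨_, ⟨s, hs, rfl⟩, le_rfl⟩
  · rintro ⟨s, hs, hmax⟩
    obtain ⟨s', hs', h1, h2, hle⟩ := key s hs
    exact ⟨s', hs', h1, h2, fun t ht => (hmax t ht).trans hle⟩
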